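/- Let F be a self-dual complex antisymmetric 2-tensor with F² = F_{γδ}F^{γδ}, let σ be a complex number with σ ≠ 1, and define Q_{αβμν} = (1−σ)^{-1}(F_{αβ} F_{μν} − (1/3) F² I_{αβμν}) where I_{αβμν} = (g_{αμ} g_{βν} − g_{αν} g_{βμ} + i ε_{αβμν})/4. Then Q is a self-dual Weyl field: it has the symmetries Q_{αβμν} = −Q_{βαμν} = −Q_{αβνμ} = Q_{μναβ}, it satisfies the first Bianchi identity Q_{αβμν} + Q_{αμνβ} + Q_{ανβμ} = 0, it is trace-free g^{βν} Q_{αβμν} = 0, and (1/2) ε_{μνρσ} Q_{αβ}{}^{ρσ} = −i Q_{αβμν}. -/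

import Mathlib

open scoped BigOperators

noncomputable section

/-- Components of the Minkowski metric (equal to those of the inverse metric)
in an orthonormal basis of a 4-dimensional Lorentzian vector space. -/
def gc (i j : Fin 4) : ℂ := if i = j then (if i = 0 then -1 else 1) else 0

/-- The volume form with its last two indices raised: ε_{ab}{}^{μν}. -/
def epsUp (ε : Fin 4 → Fin 4 → Fin 4 → Fin 4 → ℂ) (a b μ ν : Fin 4) : ℂ :=
  ∑ c, ∑ d, gc μ c * gc ν d * ε a b c d

/-- Hodge dual of an antisymmetric 2-tensor: (*F)_{ab} = (1/2) ε_{ab}{}^{μν} F_{μν}. -/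
def hodge (ε : Fin 4 → Fin 4 → Fin 4 → Fin 4 → ℂ) (F : Fin 4 → Fin 4 → ℂ)
    (a b : Fin 4) : ℂ :=
  (1/2) * ∑ μ, ∑ ν, epsUp ε a b μ ν * F μ ν

/-- The scalar F² = F_{γδ} F^{γδ}. -/
def Fsq (F : Fin 4 → Fin 4 → ℂ) : ℂ :=
  ∑ γ, ∑ δ, F γ δ * (∑ c, ∑ d, gc γ c * gc δ d * F c d)

/-- The tensor I_{αβμν} = (g_{αμ} g_{βν} − g_{αν} g_{βμ} + i ε_{αβμν})/4. -/
def Iten (ε : Fin 4 → Fin 4 → Fin 4 → Fin 4 → ℂ) (α β μ ν : Fin 4) : ℂ :=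
  (gc α μ * gc β ν - gc α ν * gc β μ + Complex.I * ε α β μ ν) / 4

/-- The tensor Q_{αβμν} = (1−σ)⁻¹ (F_{αβ} F_{μν} − (1/3) F² I_{αβμν}). -/
def Qten (ε : Fin 4 → Fin 4 → Fin 4 → Fin 4 → ℂ) (F : Fin 4 → Fin 4 → ℂ)
    (s : ℂ) (α β μ ν : Fin 4) : ℂ :=
  (1 - s)⁻¹ * (F α β * F μ ν - (1/3) * Fsq F * Iten ε α β μ ν)

/-- A 4-tensor on a 4-dimensional space that changes sign under adjacent transpositions of its
indices vanishes as soon as its `0123` component does. -/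
theorem alternating_eq_zero (D : Fin 4 → Fin 4 → Fin 4 → Fin 4 → ℂ)
    (h1 : ∀ a b c d, D a b c d = - D b a c d)
    (h2 : ∀ a b c d, D a b c d = - D a c b d)
    (h3 : ∀ a b c d, D a b c d = - D a b d c)
    (h0 : D 0 1 2 3 = 0) (a b c d : Fin 4) : D a b c d = 0 := by
  have e1 : ∀ a c d, D a a c d = 0 := fun a c d => self_eq_neg.mp (h1 a a c d)
  have e2 : ∀ a b d, D a b b d = 0 := fun a b d => self_eq_neg.mp (h2 a b b d)
  have e3 : ∀ a b c, D a b c c = 0 := fun a b c => self_eq_neg.mp (h3 a b c c)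
  have s1 : ∀ a b c d, D b a c d = 0 → D a b c d = 0 := fun a b c d h => by rw [h1, h, neg_zero]
  have s2 : ∀ a b c d, D a c b d = 0 → D a b c d = 0 := fun a b c d h => by rw [h2, h, neg_zero]
  have s3 : ∀ a b c d, D a b d c = 0 → D a b c d = 0 := fun a b c d h => by rw [h3, h, neg_zero]
  have sorted : ∀ a b c d : Fin 4, a ≤ b → b ≤ c → c ≤ d → D a b c d = 0 := by
    intro a b c d hab hbc hcd
    rcases hab.eq_or_lt with rfl | hab
    · exact e1 ..
    rcases hbc.eq_or_lt with rfl | hbc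
    · exact e2 ..
    rcases hcd.eq_or_lt with rfl | hcd
    · exact e3 ..
    obtain ⟨rfl, rfl, rfl, rfl⟩ : a = 0 ∧ b = 1 ∧ c = 2 ∧ d = 3 := by omega
    exact h0
  have sorted₃ : ∀ a b c d : Fin 4, b ≤ c → c ≤ d → D a b c d = 0 := by
    intro a b c d hbc hcd
    rcases le_total a b with hab | hab
    · exact sorted _ _ _ _ hab hbc hcd
    apply s1
    rcases le_total a c with hac | hac
    · exact sorted _ _ _ _ hab hac hcd
    apply s2
    rcases le_total a d with had | had
    · exact sorted _ _ _ _ hbc hac had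
    exact s3 _ _ _ _ (sorted _ _ _ _ hbc hcd had)
  have sorted₂ : ∀ a b c d : Fin 4, c ≤ d → D a b c d = 0 := by
    intro a b c d hcd
    rcases le_total b c with hbc | hbc
    · exact sorted₃ _ _ _ _ hbc hcd
    apply s2
    rcases le_total b d with hbd | hbd
    · exact sorted₃ _ _ _ _ hbc hbd
    exact s3 _ _ _ _ (sorted₃ _ _ _ _ hcd hbd)
  rcases le_total c d with hcd | hcd
  · exact sorted₂ _ _ _ _ hcd
  · exact s3 _ _ _ _ (sorted₂ _ _ _ _ hcd)

/-- The Levi-Civita symbol, as a normalized Vandermonde product. -/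
def leviCivita (a b c d : Fin 4) : ℤ :=
  ((b : ℤ) - a) * (c - a) * (d - a) * (c - b) * (d - b) * (d - c) / 12

theorem leviCivita_swap₁ : ∀ a b c d, leviCivita a b c d = - leviCivita b a c d := by
  decide +kernel

theorem leviCivita_swap₂ : ∀ a b c d, leviCivita a b c d = - leviCivita a c b d := by
  decide +kernel

theorem leviCivita_swap₃ : ∀ a b c d, leviCivita a b c d = - leviCivita a b d c := by
  decide +kernel

theorem leviCivita_pair_symm : ∀ a b c d, leviCivita a b c d = leviCivita c d a b := by
  decide +kernel

theorem eq_leviCivita (ε : Fin 4 → Fin 4 → Fin 4 → Fin 4 → ℂ)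
    (h1 : ∀ a b c d, ε a b c d = - ε b a c d)
    (h2 : ∀ a b c d, ε a b c d = - ε a c b d)
    (h3 : ∀ a b c d, ε a b c d = - ε a b d c)
    (hnorm : ε 0 1 2 3 = 1) (a b c d : Fin 4) : ε a b c d = leviCivita a b c d := by
  refine sub_eq_zero.mp (alternating_eq_zero
    (fun a b c d => ε a b c d - leviCivita a b c d) ?_ ?_ ?_ ?_ a b c d)
  · intro a b c d
    rw [h1, leviCivita_swap₁]; push_cast; ring
  · intro a b c d
    rw [h2, leviCivita_swap₂]; push_cast; ring
  · intro a b c d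
    rw [h3, leviCivita_swap₃]; push_cast; ring
  · have : leviCivita 0 1 2 3 = 1 := by decide
    simp [hnorm, this]

/-- The diagonal entries of the Minkowski metric. -/
def minkowskiSign (i : Fin 4) : ℤ := if i = 0 then -1 else 1

theorem gc_eq (i j : Fin 4) : gc i j = ((if i = j then minkowskiSign i else 0 : ℤ) : ℂ) := by
  unfold gc minkowskiSign; split_ifs <;> simp

theorem gc_comm (i j : Fin 4) : gc i j = gc j i := by
  unfold gc; grind

theorem sum_gc_mul (i : Fin 4) (f : Fin 4 → ℂ) :
    ∑ j, gc i j * f j = minkowskiSign i * f i := by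
  simp [gc_eq]

theorem sum_sum_gc_mul (i j : Fin 4) (f : Fin 4 → Fin 4 → ℂ) :
    ∑ c, ∑ d, gc i c * gc j d * f c d = minkowskiSign i * minkowskiSign j * f i j := by
  simp_rw [mul_assoc, ← Finset.mul_sum, sum_gc_mul]

theorem leviCivita_contract_metric : ∀ m n a b : Fin 4,
    ∑ r, ∑ t, leviCivita m n r t * (minkowskiSign r * minkowskiSign t *
      ((if a = r then minkowskiSign a else 0) * (if b = t then minkowskiSign b else 0) -
        (if a = t then minkowskiSign a else 0) * (if b = r then minkowskiSign b else 0)))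
      = 2 * leviCivita a b m n := by
  decide +kernel

theorem leviCivita_contract_leviCivita : ∀ m n a b : Fin 4,
    ∑ r, ∑ t, leviCivita m n r t * (minkowskiSign r * minkowskiSign t * leviCivita a b r t)
      = -2 * ((if a = m then minkowskiSign a else 0) * (if b = n then minkowskiSign b else 0) -
        (if a = n then minkowskiSign a else 0) * (if b = m then minkowskiSign b else 0)) := by
  decide +kernel

/-- The tensor Q is a self-dual Weyl field: it has the symmetries of a Weyl
tensor, satisfies the first Bianchi identity, is trace-free, and is self-dual. -/
theorem Qten_self_dual_Weyl
    (ε : Fin 4 → Fin 4 → Fin 4 → Fin 4 → ℂ)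
    (h1 : ∀ a b c d, ε a b c d = - ε b a c d)
    (h2 : ∀ a b c d, ε a b c d = - ε a c b d)
    (h3 : ∀ a b c d, ε a b c d = - ε a b d c)
    (hnorm : ε 0 1 2 3 = 1)
    (F : Fin 4 → Fin 4 → ℂ)
    (hF : ∀ a b, F a b = - F b a)
    (hFsd : ∀ a b, hodge ε F a b = -Complex.I * F a b)
    (s : ℂ) (hs : s ≠ 1) :
    (∀ α β μ ν, Qten ε F s α β μ ν = - Qten ε F s β α μ ν) ∧
    (∀ α β μ ν, Qten ε F s α β μ ν = - Qten ε F s α β ν μ) ∧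
    (∀ α β μ ν, Qten ε F s α β μ ν = Qten ε F s μ ν α β) ∧
    (∀ α β μ ν, Qten ε F s α β μ ν + Qten ε F s α μ ν β
        + Qten ε F s α ν β μ = 0) ∧
    (∀ α μ, (∑ b, ∑ n, gc b n * Qten ε F s α b μ n) = 0) ∧
    (∀ α β μ ν, (1/2) * (∑ ρ, ∑ σ, ε μ ν ρ σ *
        (∑ c, ∑ d, gc ρ c * gc σ d * Qten ε F s α β c d))
      = -Complex.I * Qten ε F s α β μ ν) := by
  obtain rfl : ε = fun a b c d => (leviCivita a b c d : ℂ) := by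
    funext a b c d; exact eq_leviCivita ε h1 h2 h3 hnorm a b c d
  have hdual : ∀ a b, ∑ r, ∑ t, (leviCivita a b r t : ℂ) *
      (minkowskiSign r * minkowskiSign t * F r t) = -2 * Complex.I * F a b := by
    intro a b
    have h := hFsd a b
    simp only [hodge, epsUp, sum_sum_gc_mul] at h
    rw [show -2 * Complex.I * F a b = 2 * (-Complex.I * F a b) by ring, ← h]
    simp only [← mul_assoc]
    norm_num
    refine Finset.sum_congr rfl fun r _ => Finset.sum_congr rfl fun t _ => ?_
    ring
  have hdiag : ∀ a, F a a = 0 := fun a => self_eq_neg.mp (hF a a)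
  have hF23 : F 2 3 = -Complex.I * F 0 1 := by
    have h := hdual 0 1
    simp [Fin.sum_univ_four, leviCivita, minkowskiSign, hF 3 2] at h
    linear_combination h / 2
  have hF13 : F 1 3 = Complex.I * F 0 2 := by
    have h := hdual 0 2
    simp [Fin.sum_univ_four, leviCivita, minkowskiSign, hF 3 1] at h
    linear_combination -h / 2
  have hF12 : F 1 2 = -Complex.I * F 0 3 := by
    have h := hdual 0 3
    simp [Fin.sum_univ_four, leviCivita, minkowskiSign, hF 2 1] at h
    linear_combination h / 2
  have hFsq : Fsq F = -4 * (F 0 1 ^ 2 + F 0 2 ^ 2 + F 0 3 ^ 2) := by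
    simp only [Fsq, sum_sum_gc_mul]
    simp [Fin.sum_univ_four, minkowskiSign, hdiag, hF 1 0, hF 2 0, hF 3 0, hF 2 1, hF 3 1,
      hF 3 2, hF23, hF13, hF12]
    ring_nf
    simp
    ring
  have hQ1 : ∀ α β μ ν, Qten (fun a b c d => (leviCivita a b c d : ℂ)) F s α β μ ν =
      - Qten (fun a b c d => (leviCivita a b c d : ℂ)) F s β α μ ν := by
    intro α β μ ν
    simp only [Qten, Iten]
    rw [hF α β, leviCivita_swap₁ α β μ ν]
    push_cast
    ring
  have hQ2 : ∀ α β μ ν, Qten (fun a b c d => (leviCivita a b c d : ℂ)) F s α β μ ν =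
      - Qten (fun a b c d => (leviCivita a b c d : ℂ)) F s α β ν μ := by
    intro α β μ ν
    simp only [Qten, Iten]
    rw [hF μ ν, leviCivita_swap₃ α β μ ν]
    push_cast
    ring
  have hQ3 : ∀ α β μ ν, Qten (fun a b c d => (leviCivita a b c d : ℂ)) F s α β μ ν =
      Qten (fun a b c d => (leviCivita a b c d : ℂ)) F s μ ν α β := by
    intro α β μ ν
    simp only [Qten, Iten]
    rw [leviCivita_pair_symm α β μ ν, gc_comm α μ, gc_comm β ν, gc_comm α ν, gc_comm β μ]
    ring
  refine ⟨hQ1, hQ2, hQ3, ?_, ?_, ?_⟩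
  · refine alternating_eq_zero _ ?_ ?_ ?_ ?_
    · intro a b c d
      linear_combination hQ1 a b c d + hQ2 a c d b - hQ3 a c b d + hQ1 a d b c - hQ3 d a b c
    · intro a b c d
      linear_combination hQ2 a b c d + hQ2 a c d b + hQ2 a d b c
    · intro a b c d
      linear_combination hQ2 a b c d + hQ2 a c d b + hQ2 a d b c
    · have e1 : leviCivita 0 1 2 3 = 1 := by decide
      have e2 : leviCivita 0 2 3 1 = 1 := by decide
      have e3 : leviCivita 0 3 1 2 = 1 := by decide
      simp [Qten, Iten, gc, e1, e2, e3, hFsq, hF 3 1, hF23, hF13, hF12]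
      ring
  · intro α μ
    simp only [Qten, Iten, hFsq, gc_eq]
    fin_cases α <;> fin_cases μ <;>
    · simp [Fin.sum_univ_four, leviCivita, minkowskiSign, hdiag, hF 1 0, hF 2 0, hF 3 0,
        hF 2 1, hF 3 1, hF 3 2, hF23, hF13, hF12]
      try ring_nf
      try simp
      try ring
  · intro α β μ ν
    simp only [sum_sum_gc_mul]
    have hG := congrArg (Int.cast : ℤ → ℂ) (leviCivita_contract_metric μ ν α β)
    have hE := congrArg (Int.cast : ℤ → ℂ) (leviCivita_contract_leviCivita μ ν α β)
    have hD := hdual μ ν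
    simp only [Int.cast_sum, Int.cast_mul, Int.cast_sub, Int.cast_neg, Int.cast_ofNat,
      ← gc_eq] at hG hE
    have hlin : ∑ r, ∑ t, (leviCivita μ ν r t : ℂ) * (minkowskiSign r * minkowskiSign t *
          Qten (fun a b c d => (leviCivita a b c d : ℂ)) F s α β r t)
        = (1 - s)⁻¹ * (F α β * ∑ r, ∑ t, (leviCivita μ ν r t : ℂ) *
            (minkowskiSign r * minkowskiSign t * F r t)
          - (1/3) * Fsq F * ((∑ r, ∑ t, (leviCivita μ ν r t : ℂ) *
              (minkowskiSign r * minkowskiSign t * (gc α r * gc β t - gc α t * gc β r))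
            + Complex.I * ∑ r, ∑ t, (leviCivita μ ν r t : ℂ) *
              (minkowskiSign r * minkowskiSign t * leviCivita α β r t)) / 4)) := by
      simp only [Qten, Iten, Finset.mul_sum, ← Finset.sum_add_distrib, Finset.sum_div,
        ← Finset.sum_sub_distrib]
      refine Finset.sum_congr rfl fun r _ => Finset.sum_congr rfl fun t _ => ?_
      ring
    rw [hlin, hD, hG, hE]
    simp only [Qten, Iten]
    linear_combination (-(1 - s)⁻¹ * Fsq F / 12 * leviCivita α β μ ν) * Complex.I_sq
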